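/- arXiv:2604.16141 — 3 statements merged into one kernel-verified Lean document; each statement's English description precedes it below -/
import Mathlib

section
/- Let Δ₁, Δ₂, Δ₃ be finite sets each of cardinality at least 2. Then d(Sym(Δ₁) ≀_{Δ₂×Δ₃} (Sym(Δ₂) × Sym(Δ₃))) = 3, where Sym(Δ₂) × Sym(Δ₃) acts on the index set Δ₂ × Δ₃ componentwise: (g, h) • (δ₂, δ₃) = (g(δ₂), h(δ₃)). -/
/-- minimal number of generators of a group -/
noncomputable def d (G : Type*) [Group G] : ℕ :=
  sInf {n | ∃ S : Finset G, S.card = n ∧ Subgroup.closure (S : Set G) = ⊤}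

/-- the coordinate-permuting action of `G` on `X → H`, where `G` acts on `X` via `ρ`. -/
def wrAction (H : Type*) [Group H] {X G : Type*} [Group G]
    (ρ : G →* Equiv.Perm X) : G →* MulAut (X → H) where
  toFun g :=
    { toFun := fun f x => f ((ρ g)⁻¹ x)
      invFun := fun f x => f (ρ g x)
      left_inv := fun f => funext fun x => by simp
      right_inv := fun f => funext fun x => by simp
      map_mul' := fun f₁ f₂ => rfl }
  map_one' := by ext f x; simp
  map_mul' := fun g₁ g₂ => by ext f x; simp [mul_inv_rev]

/-- The wreath product `H ≀_X G`, where `G` acts on `X` via `ρ`. -/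
abbrev Wr (H : Type*) [Group H] {X G : Type*} [Group G] (ρ : G →* Equiv.Perm X) : Type _ :=
  SemidirectProduct (X → H) G (wrAction H ρ)

/-- the componentwise action `(g, h) • (δ₂, δ₃) = (g δ₂, h δ₃)` as a homomorphism. -/
def prodPermHom (α β : Type*) : Equiv.Perm α × Equiv.Perm β →* Equiv.Perm (α × β) where
  toFun p := Equiv.prodCongr p.1 p.2
  map_one' := Equiv.ext fun _ => rfl
  map_mul' := fun _ _ => Equiv.ext fun _ => rfl

/-- An element of odd order and an involution (or trivial element) that together generate `G`. -/
def IsOddInvolutiveGenPair {G : Type*} [Group G] (a b : G) : Prop :=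
  (∃ n, Odd n ∧ a ^ n = 1) ∧ b ^ 2 = 1 ∧ Subgroup.closure {a, b} = ⊤

/-- A product of an element of odd order with a commuting involution can be separated. -/
lemma Subgroup.mem_and_mem_of_mul_mem {G : Type*} [Group G] {K : Subgroup G} {a b : G} {n : ℕ}
    (hn : Odd n) (ha : a ^ n = 1) (hb : b ^ 2 = 1) (hab : Commute a b) (h : a * b ∈ K) :
    a ∈ K ∧ b ∈ K := by
  have hbK : b ∈ K := by
    obtain ⟨m, rfl⟩ := hn
    have := K.pow_mem h (2 * m + 1)
    rwa [hab.mul_pow, ha, one_mul, pow_succ, pow_mul, hb, one_pow, one_mul] at this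
  exact ⟨(K.mul_mem_cancel_right hbK).mp h, hbK⟩

/-- The transpositions moving a fixed point generate the symmetric group. -/
lemma Equiv.Perm.eq_top_of_swap_mem {α : Type*} [Fintype α] [DecidableEq α]
    {K : Subgroup (Equiv.Perm α)} (a : α) (h : ∀ x, x ≠ a → Equiv.swap a x ∈ K) : K = ⊤ := by
  have h' : ∀ x, Equiv.swap a x ∈ K := fun x => by
    by_cases hx : x = a
    · rw [hx, Equiv.swap_self]
      exact K.one_mem
    · exact h x hx
  rw [eq_top_iff, ← Equiv.Perm.closure_isSwap, Subgroup.closure_le]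
  rintro _ ⟨x, y, hxy, rfl⟩
  by_cases hy : y = a
  · rw [hy, Equiv.swap_comm]
    exact h' x
  by_cases hx : x = a
  · rw [hx]
    exact h' y
  have key : Equiv.swap x y = Equiv.swap a x * Equiv.swap a y * (Equiv.swap a x)⁻¹ := by
    rw [Equiv.mul_swap_eq_swap_mul, mul_inv_cancel_right, Equiv.swap_apply_left,
      Equiv.swap_apply_of_ne_of_ne hy (Ne.symm hxy)]
  rw [key]
  exact K.mul_mem (K.mul_mem (h' x) (h' y)) (K.inv_mem (h' x))

lemma Equiv.Perm.IsCycleOn.pow_card_eq_one {α : Type*} [Fintype α] [DecidableEq α]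
    {f : Equiv.Perm α} {s : Finset α} (hf : f.IsCycleOn s) (hs : f.support ⊆ s) :
    f ^ s.card = 1 := by
  ext x
  by_cases hx : x ∈ s
  · rw [hf.pow_card_apply hx, Equiv.Perm.one_apply]
  · rw [Equiv.Perm.pow_apply_eq_self_of_apply_eq_self
      (Equiv.Perm.notMem_support.mp fun h => hx (hs h)), Equiv.Perm.one_apply]

lemma Equiv.Perm.exists_isOddInvolutiveGenPair (α : Type*) [Fintype α]
    (h : 2 ≤ Fintype.card α) : ∃ a b : Equiv.Perm α, IsOddInvolutiveGenPair a b := by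
  classical
  have : Nontrivial α := Fintype.one_lt_card_iff_nontrivial.mp h
  rcases Nat.even_or_odd (Fintype.card α) with he | ho
  · obtain ⟨a, b, hab⟩ := exists_pair_ne α
    obtain ⟨f, hf, hs⟩ := (Finset.univ.erase a).exists_cycleOn
    refine ⟨f, Equiv.swap a b, ⟨_, ?_, hf.pow_card_eq_one hs⟩, by simp [pow_two], ?_⟩
    · rw [Finset.card_erase_of_mem (Finset.mem_univ a), Finset.card_univ]
      exact Nat.Even.sub_odd (by omega) he odd_one
    · refine Equiv.Perm.eq_top_of_swap_mem a fun x hx => ?_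
      obtain ⟨i, rfl⟩ := hf.2 (x := b) (y := x) (by simpa using hab.symm) (by simpa using hx)
      have hfa : (f ^ i) a = a := Equiv.Perm.zpow_apply_eq_self_of_apply_eq_self
        (Equiv.Perm.notMem_support.mp fun h => by simpa using hs h) i
      have key : Equiv.swap a ((f ^ i) b) = f ^ i * Equiv.swap a b * (f ^ i)⁻¹ := by
        rw [Equiv.mul_swap_eq_swap_mul, mul_inv_cancel_right, hfa]
      have hfK := Subgroup.zpow_mem _
        (Subgroup.subset_closure (Set.mem_insert f {Equiv.swap a b})) i
      rw [key]
      exact Subgroup.mul_mem _ (Subgroup.mul_mem _ hfK (Subgroup.subset_closure (by simp)))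
        (Subgroup.inv_mem _ hfK)
  · obtain ⟨f, hf, hs⟩ := (Finset.univ : Finset α).exists_cycleOn
    obtain ⟨x⟩ : Nonempty α := inferInstance
    have hne : ∀ y, f y ≠ y := fun y =>
      hf.apply_ne (by simpa using Set.nontrivial_univ) (by simp)
    have hcyc : f.IsCycle := ⟨x, hne x, fun y _ => hf.2 (by simp) (by simp)⟩
    exact ⟨f, Equiv.swap x (f x), ⟨_, ho, hf.pow_card_eq_one hs⟩, by simp [pow_two],
      Equiv.Perm.closure_cycle_adjacent_swap hcyc
        (Finset.eq_univ_iff_forall.mpr fun y => Equiv.Perm.mem_support.mpr (hne y)) x⟩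

lemma IsOddInvolutiveGenPair.closure_prod_eq_top {G H : Type*} [Group G] [Group H] {a b : G}
    {c e : H} (h : IsOddInvolutiveGenPair a b) (h' : IsOddInvolutiveGenPair c e) :
    Subgroup.closure {((a, e) : G × H), (b, c)} = ⊤ := by
  obtain ⟨⟨n, hn, ha⟩, hb, hab⟩ := h
  obtain ⟨⟨m, hm, hc⟩, he, hce⟩ := h'
  set K := Subgroup.closure {((a, e) : G × H), (b, c)} with hK
  obtain ⟨haK, heK⟩ := Subgroup.mem_and_mem_of_mul_mem (K := K) (a := ((a, 1) : G × H))
    (b := (1, e)) hn (by simp [ha]) (by simp [he]) (by simp [Commute, SemiconjBy])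
    (Subgroup.subset_closure (by simp))
  obtain ⟨hcK, hbK⟩ := Subgroup.mem_and_mem_of_mul_mem (K := K) (a := ((1, c) : G × H))
    (b := (b, 1)) hm (by simp [hc]) (by simp [hb]) (by simp [Commute, SemiconjBy])
    (Subgroup.subset_closure (by simp))
  have hl : K.comap (MonoidHom.inl G H) = ⊤ := by
    rw [eq_top_iff, ← hab, Subgroup.closure_le]
    rintro x (rfl | rfl)
    exacts [haK, hbK]
  have hr : K.comap (MonoidHom.inr G H) = ⊤ := by
    rw [eq_top_iff, ← hce, Subgroup.closure_le]
    rintro x (rfl | rfl)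
    exacts [hcK, heK]
  refine (Subgroup.eq_top_iff' K).mpr fun x => ?_
  have h1 : x.1 ∈ K.comap (MonoidHom.inl G H) := hl ▸ Subgroup.mem_top _
  have h2 : x.2 ∈ K.comap (MonoidHom.inr G H) := hr ▸ Subgroup.mem_top _
  simpa using K.mul_mem h1 h2

lemma wrAction_mulSingle {H X G : Type*} [Group H] [Group G] [DecidableEq X]
    (ρ : G →* Equiv.Perm X) (g : G) (x : X) (s : H) :
    wrAction H ρ g (Pi.mulSingle x s) = Pi.mulSingle (ρ g x) s := by
  funext y
  change (Pi.mulSingle x s : X → H) ((ρ g)⁻¹ y) = _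
  simp only [Pi.mulSingle_apply, Equiv.Perm.inv_eq_iff_eq]

/-- If `G` acts transitively, a wreath product `H ≀_X G` is generated by generators of `G` together
with a single element of the base group, provided `H` has an `IsOddInvolutiveGenPair`. -/
lemma Wr.closure_eq_top {H X G : Type*} [Group H] [Group G] [Finite X] [DecidableEq X]
    {ρ : G →* Equiv.Perm X} (hρ : ∀ x y, ∃ g, ρ g x = y) {x y : X} (hxy : x ≠ y) {a b : H}
    (h : IsOddInvolutiveGenPair a b) {u v : G} (huv : Subgroup.closure {u, v} = ⊤) :
    Subgroup.closure {(SemidirectProduct.inl (Pi.mulSingle x a * Pi.mulSingle y b) : Wr H ρ),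
      SemidirectProduct.inr u, SemidirectProduct.inr v} = ⊤ := by
  obtain ⟨⟨n, hn, ha⟩, hb, hab⟩ := h
  set K := Subgroup.closure
    {(SemidirectProduct.inl (Pi.mulSingle x a * Pi.mulSingle y b) : Wr H ρ),
      SemidirectProduct.inr u, SemidirectProduct.inr v}
  have hr : ∀ g : G, (SemidirectProduct.inr g : Wr H ρ) ∈ K := by
    have : K.comap SemidirectProduct.inr = ⊤ := by
      rw [eq_top_iff, ← huv, Subgroup.closure_le]
      rintro z (rfl | rfl) <;> exact Subgroup.subset_closure (by simp)
    exact fun g => (Subgroup.eq_top_iff' _).mp this g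
  have hconj : ∀ (z w : X) (s : H),
      (SemidirectProduct.inl (Pi.mulSingle z s) : Wr H ρ) ∈ K →
      (SemidirectProduct.inl (Pi.mulSingle w s) : Wr H ρ) ∈ K := by
    intro z w s hs
    obtain ⟨g, rfl⟩ := hρ z w
    rw [← wrAction_mulSingle, SemidirectProduct.inl_aut]
    exact K.mul_mem (K.mul_mem (hr g) hs) (hr g⁻¹)
  obtain ⟨haK, hbK⟩ := Subgroup.mem_and_mem_of_mul_mem (K := K.comap SemidirectProduct.inl)
    (a := (Pi.mulSingle x a : X → H)) (b := Pi.mulSingle y b) hn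
    (by rw [← Pi.mulSingle_pow, ha, Pi.mulSingle_one])
    (by rw [← Pi.mulSingle_pow, hb, Pi.mulSingle_one])
    (Pi.mulSingle_commute (f := fun _ => H) hxy a b) (Subgroup.subset_closure (by simp))
  have hs : ∀ (z : X) (s : H), (SemidirectProduct.inl (Pi.mulSingle z s) : Wr H ρ) ∈ K := by
    intro z
    have : (K.comap SemidirectProduct.inl).comap (MonoidHom.mulSingle (fun _ : X => H) z) = ⊤ := by
      rw [eq_top_iff, ← hab, Subgroup.closure_le]
      rintro t (rfl | rfl)
      exacts [hconj x z _ haK, hconj y z _ hbK]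
    exact fun s => (Subgroup.eq_top_iff' _).mp this s
  refine (Subgroup.eq_top_iff' K).mpr fun w => ?_
  rw [← SemidirectProduct.inl_left_mul_inr_right w]
  exact K.mul_mem (Subgroup.mem_comap.mp
    (Subgroup.pi_mem_of_mulSingle_mem (H := K.comap SemidirectProduct.inl) _ fun i => hs i _))
    (hr _)

/-- The abelianization map of the wreath product of symmetric groups onto `C₂ × C₂ × C₂`. -/
noncomputable def Wr.signHom (Δ₁ Δ₂ Δ₃ : Type*) [Fintype Δ₁] [Fintype Δ₂] [Fintype Δ₃]
    [DecidableEq Δ₁] [DecidableEq Δ₂] [DecidableEq Δ₃] :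
    Wr (Equiv.Perm Δ₁) (prodPermHom Δ₂ Δ₃) →* ℤˣ × ℤˣ × ℤˣ :=
  SemidirectProduct.lift
    ((MonoidHom.inl ℤˣ (ℤˣ × ℤˣ)).comp
      { toFun := fun f => ∏ x, Equiv.Perm.sign (f x)
        map_one' := by simp
        map_mul' := fun f g => by simp [Finset.prod_mul_distrib] })
    ((MonoidHom.inr ℤˣ (ℤˣ × ℤˣ)).comp (Equiv.Perm.sign.prodMap Equiv.Perm.sign))
    (fun g => by
      ext1 f
      simp only [MonoidHom.comp_apply, MulEquiv.coe_toMonoidHom, MulAut.conj_apply,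
        mul_inv_cancel_comm]
      exact congrArg _ (Equiv.prod_comp (prodPermHom Δ₂ Δ₃ g)⁻¹ fun x => Equiv.Perm.sign (f x)))

lemma Wr.signHom_surjective {Δ₁ Δ₂ Δ₃ : Type*} [Fintype Δ₁] [Fintype Δ₂] [Fintype Δ₃]
    [DecidableEq Δ₁] [DecidableEq Δ₂] [DecidableEq Δ₃] [Nontrivial Δ₁] [Nontrivial Δ₂]
    [Nontrivial Δ₃] : Function.Surjective (Wr.signHom Δ₁ Δ₂ Δ₃) := by
  rintro ⟨p, q, r⟩
  obtain ⟨a, rfl⟩ := Equiv.Perm.sign_surjective Δ₁ p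
  obtain ⟨b, rfl⟩ := Equiv.Perm.sign_surjective Δ₂ q
  obtain ⟨c, rfl⟩ := Equiv.Perm.sign_surjective Δ₃ r
  obtain ⟨x⟩ : Nonempty (Δ₂ × Δ₃) := inferInstance
  refine ⟨SemidirectProduct.inl (Pi.mulSingle x a) * SemidirectProduct.inr (b, c), ?_⟩
  rw [map_mul, Wr.signHom, SemidirectProduct.lift_inl, SemidirectProduct.lift_inr]
  have : ∏ y, Equiv.Perm.sign ((Pi.mulSingle x a : Δ₂ × Δ₃ → Equiv.Perm Δ₁) y) =
      Equiv.Perm.sign a := by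
    rw [Finset.prod_eq_single x (fun y _ hy => by simp [Pi.mulSingle_eq_of_ne hy]) (by simp)]
    simp
  simp [this]

lemma closure_pair_units_int_prod_ne_top (u v : ℤˣ × ℤˣ × ℤˣ) :
    Subgroup.closure {u, v} ≠ ⊤ := by
  have hchar : ∃ i j k : Fin 2, (i, j, k) ≠ 0 ∧
      u.1 ^ (i : ℕ) * u.2.1 ^ (j : ℕ) * u.2.2 ^ (k : ℕ) = 1 ∧
      v.1 ^ (i : ℕ) * v.2.1 ^ (j : ℕ) * v.2.2 ^ (k : ℕ) = 1 := by
    revert u v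
    decide
  obtain ⟨i, j, k, hne, hu, hv⟩ := hchar
  let χ : ℤˣ × ℤˣ × ℤˣ →* ℤˣ :=
    { toFun := fun w => w.1 ^ (i : ℕ) * w.2.1 ^ (j : ℕ) * w.2.2 ^ (k : ℕ)
      map_one' := by simp
      map_mul' := fun w z => by simp only [Prod.fst_mul, Prod.snd_mul, mul_pow]; ac_rfl }
  intro htop
  have hker : χ.ker = ⊤ := by
    rw [eq_top_iff, ← htop, Subgroup.closure_le]
    rintro w (rfl | rfl)
    exacts [hu, hv]
  have hχ : ∀ w : ℤˣ × ℤˣ × ℤˣ,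
      w.1 ^ (i : ℕ) * w.2.1 ^ (j : ℕ) * w.2.2 ^ (k : ℕ) = 1 := fun w =>
    MonoidHom.mem_ker.mp (hker ▸ Subgroup.mem_top w : w ∈ χ.ker)
  clear * - hne hχ
  revert i j k
  decide

/-- A finite set with at most two elements is contained in a pair. -/
lemma Finset.exists_subset_pair {α : Type*} [Nonempty α] {s : Finset α} (h : s.card ≤ 2) :
    ∃ a b, (s : Set α) ⊆ {a, b} := by
  classical
  obtain ⟨c⟩ : Nonempty α := inferInstance
  interval_cases hs : s.card
  · exact ⟨c, c, by simp [Finset.card_eq_zero.mp hs]⟩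
  · obtain ⟨a, rfl⟩ := Finset.card_eq_one.mp hs
    exact ⟨a, a, by simp⟩
  · obtain ⟨a, b, -, rfl⟩ := Finset.card_eq_two.mp hs
    exact ⟨a, b, by simp⟩

theorem stmt_5 {Δ₁ Δ₂ Δ₃ : Type*} [Fintype Δ₁] [Fintype Δ₂] [Fintype Δ₃]
    (h1 : 2 ≤ Fintype.card Δ₁) (h2 : 2 ≤ Fintype.card Δ₂) (h3 : 2 ≤ Fintype.card Δ₃) :
    d (Wr (Equiv.Perm Δ₁) (prodPermHom Δ₂ Δ₃)) = 3 := by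
  classical
  have : Nontrivial Δ₁ := Fintype.one_lt_card_iff_nontrivial.mp h1
  have : Nontrivial Δ₂ := Fintype.one_lt_card_iff_nontrivial.mp h2
  have : Nontrivial Δ₃ := Fintype.one_lt_card_iff_nontrivial.mp h3
  obtain ⟨a₁, b₁, hab₁⟩ := Equiv.Perm.exists_isOddInvolutiveGenPair Δ₁ h1
  obtain ⟨a₂, b₂, hab₂⟩ := Equiv.Perm.exists_isOddInvolutiveGenPair Δ₂ h2
  obtain ⟨a₃, b₃, hab₃⟩ := Equiv.Perm.exists_isOddInvolutiveGenPair Δ₃ h3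
  obtain ⟨x, y, hxy⟩ := exists_pair_ne (Δ₂ × Δ₃)
  have htrans : ∀ z w : Δ₂ × Δ₃, ∃ g, prodPermHom Δ₂ Δ₃ g z = w := fun z w =>
    ⟨(Equiv.swap z.1 w.1, Equiv.swap z.2 w.2), by
      ext <;> simp [prodPermHom]⟩
  have hgen := Wr.closure_eq_top htrans hxy hab₁ (hab₂.closure_prod_eq_top hab₃)
  have hmem : ∃ S : Finset (Wr (Equiv.Perm Δ₁) (prodPermHom Δ₂ Δ₃)), S.card ≤ 3 ∧
      Subgroup.closure (S : Set (Wr (Equiv.Perm Δ₁) (prodPermHom Δ₂ Δ₃))) = ⊤ :=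
    ⟨{_, _, _}, Finset.card_le_three, by simpa using hgen⟩
  obtain ⟨S, hS, hStop⟩ := hmem
  refine le_antisymm (le_trans (Nat.sInf_le ⟨S, rfl, hStop⟩) hS) ?_
  refine le_csInf ⟨_, S, rfl, hStop⟩ ?_
  rintro _ ⟨T, rfl, hT⟩
  by_contra! hlt
  obtain ⟨u, v, huv⟩ := Finset.exists_subset_pair (Nat.le_of_lt_succ hlt)
  have htop : Subgroup.closure {u, v} = ⊤ :=
    top_le_iff.mp (hT ▸ Subgroup.closure_mono huv)
  apply closure_pair_units_int_prod_ne_top (Wr.signHom Δ₁ Δ₂ Δ₃ u) (Wr.signHom Δ₁ Δ₂ Δ₃ v)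
  rw [← Set.image_pair, ← MonoidHom.map_closure, htop,
    Subgroup.map_top_of_surjective _ Wr.signHom_surjective]
end

section
/- Let Δ₁, Δ₂, Δ₃ be finite sets each of cardinality at least 2. Then d(Sym(Δ₁) × (Sym(Δ₂) ≀_{Δ₃} Sym(Δ₃))) = 3, where Sym(Δ₃) acts on the index set Δ₃ by its natural action. -/
open Equiv in
/-- A subgroup containing all transpositions moving a given point is the whole symmetric group. -/
theorem eq_top_of_swap_mem {α : Type*} [Finite α] [DecidableEq α] (H : Subgroup (Perm α)) (a : α)
    (h : ∀ b, swap a b ∈ H) : H = ⊤ := by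
  rw [eq_top_iff, ← Perm.closure_isSwap, Subgroup.closure_le]
  rintro _ ⟨x, y, -, rfl⟩
  exact SubmonoidClass.swap_mem_trans (a := x) (b := a) (c := y) H
    (by rw [swap_comm]; exact h x) (h y)

open Equiv in
theorem swap_apply_mem {α : Type*} [DecidableEq α] {H : Subgroup (Perm α)} {c : Perm α}
    {x y : α} (hc : c ∈ H) (h : swap x y ∈ H) : swap (c x) (c y) ∈ H := by
  rw [swap_apply_apply]
  exact H.mul_mem (H.mul_mem hc h) (H.inv_mem hc)

/-- `G` is generated by an element squaring to one and an element of odd order. -/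
def HasInvolutionOddGenerators (G : Type*) [Group G] : Prop :=
  ∃ s c : G, s ^ 2 = 1 ∧ (∃ k, Odd k ∧ c ^ k = 1) ∧
    ∀ H : Subgroup G, s ∈ H → c ∈ H → H = ⊤

theorem HasInvolutionOddGenerators.of_mulEquiv {G G' : Type*} [Group G] [Group G'] (e : G ≃* G')
    (h : HasInvolutionOddGenerators G) : HasInvolutionOddGenerators G' := by
  obtain ⟨s, c, hs, ⟨k, hk, hc⟩, hH⟩ := h
  refine ⟨e s, e c, by rw [← map_pow, hs, map_one], ⟨k, hk, by rw [← map_pow, hc, map_one]⟩, ?_⟩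
  intro H h1 h2
  have h3 := hH (H.comap e.toMonoidHom) h1 h2
  rw [eq_top_iff]
  intro x _
  have h4 : e.symm x ∈ H.comap e.toMonoidHom := h3 ▸ Subgroup.mem_top _
  simpa using h4

open Equiv in
theorem hasInvolutionOddGenerators_perm_zmod {n : ℕ} [NeZero n] (hn : Odd n) :
    HasInvolutionOddGenerators (Perm (ZMod n)) := by
  refine ⟨swap 0 1, Equiv.addRight 1, by rw [pow_two, swap_mul_self], ⟨n, hn, ?_⟩, ?_⟩
  · have key (k : ℕ) : (Equiv.addRight (1 : ZMod n) : Perm (ZMod n)) ^ k =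
        Equiv.addRight (k : ZMod n) := by
      induction k with
      | zero => ext1 x; simp
      | succ k ih => rw [pow_succ', ih]; ext1 x; simp [add_assoc]
    rw [key]; ext1 x; simp
  · intro H h1 h2
    have hadj : ∀ i : ℕ, swap (i : ZMod n) (i + 1) ∈ H := by
      intro i
      induction i with
      | zero => simpa using h1
      | succ i ih => simpa using swap_apply_mem h2 ih
    refine eq_top_of_swap_mem H 0 fun b => ?_
    obtain ⟨i, rfl⟩ := ZMod.natCast_zmod_surjective b
    induction i with
    | zero => rw [Nat.cast_zero, swap_self]; exact H.one_mem
    | succ i ih =>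
      rw [Nat.cast_succ]
      exact SubmonoidClass.swap_mem_trans H ih (hadj i)

open Equiv in
theorem hasInvolutionOddGenerators_perm_option_zmod {n : ℕ} [NeZero n] (hn : Odd n) :
    HasInvolutionOddGenerators (Perm (Option (ZMod n))) := by
  refine ⟨swap none (some 0), optionCongr (Equiv.addRight 1), by rw [pow_two, swap_mul_self],
    ⟨n, hn, ?_⟩, ?_⟩
  · have key : ∀ k : ℕ, (optionCongr (Equiv.addRight (1 : ZMod n)) : Perm (Option (ZMod n))) ^ k =
        optionCongr (Equiv.addRight (k : ZMod n)) := by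
      intro k
      induction k with
      | zero => ext1 x; cases x <;> simp
      | succ k ih =>
        rw [pow_succ', ih]
        ext1 x; cases x <;> simp [add_assoc]
    rw [key]; ext1 x; cases x <;> simp
  · intro H h1 h2
    refine eq_top_of_swap_mem H none fun b => ?_
    cases b with
    | none => rw [swap_self]; exact H.one_mem
    | some b =>
      obtain ⟨i, rfl⟩ := ZMod.natCast_zmod_surjective b
      induction i with
      | zero => simpa using h1
      | succ i ih => simpa using swap_apply_mem h2 ih

open Equiv in
theorem hasInvolutionOddGenerators_perm (α : Type*) [Fintype α] (h : 2 ≤ Fintype.card α) :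
    HasInvolutionOddGenerators (Perm α) := by
  rcases Nat.even_or_odd (Fintype.card α) with he | ho
  · have : NeZero (Fintype.card α - 1) := ⟨by omega⟩
    have hcard : Fintype.card (Option (ZMod (Fintype.card α - 1))) = Fintype.card α := by
      rw [Fintype.card_option, ZMod.card]; omega
    exact (hasInvolutionOddGenerators_perm_option_zmod
      (Nat.Even.sub_odd (by omega) he odd_one)).of_mulEquiv (Fintype.equivOfCardEq hcard).permCongrHom
  · have : NeZero (Fintype.card α) := ⟨by omega⟩
    exact (hasInvolutionOddGenerators_perm_zmod ho).of_mulEquiv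
      (Fintype.equivOfCardEq (ZMod.card _)).permCongrHom

theorem Commute.mem_and_mem_of_mul_mem {G : Type*} [Group G] {H : Subgroup G} {s c : G}
    (h : Commute s c) (hs : s ^ 2 = 1) (hc : ∃ k, Odd k ∧ c ^ k = 1) (hm : s * c ∈ H) :
    s ∈ H ∧ c ∈ H := by
  obtain ⟨k, ⟨l, rfl⟩, hk⟩ := hc
  have h1 : (s * c) ^ (2 * l + 1) = s := by
    rw [h.mul_pow, hk, mul_one, pow_succ, pow_mul, hs, one_pow, one_mul]
  have h2 : s ∈ H := h1 ▸ H.pow_mem hm _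
  exact ⟨h2, (H.mul_mem_cancel_left h2).1 hm⟩

section Wreath

open Equiv SemidirectProduct

@[simp]
theorem wrAction_apply {H X G : Type*} [Group H] [Group G] (ρ : G →* Perm X) (g : G) (f : X → H)
    (x : X) : wrAction H ρ g f x = f ((ρ g)⁻¹ x) := rfl

theorem inr_mul_inl_mulSingle_mul_inv {B X : Type*} [Group B] [DecidableEq X] (g : Perm X) (x : X)
    (b : B) : (inr g * inl (Pi.mulSingle x b) * (inr g)⁻¹ : Wr B (MonoidHom.id (Perm X))) =
      inl (Pi.mulSingle (g x) b) := by
  rw [← map_inv, ← inl_aut]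
  congr 1
  funext z
  simp [Pi.mulSingle_apply, Equiv.symm_apply_eq]

/-- A subgroup of the wreath product containing the top group and one coordinate of the base group
is the whole wreath product. -/
theorem eq_top_of_inr_mem_of_inl_mem {B X : Type*} [Group B] [Finite X] [DecidableEq X]
    (K : Subgroup (Wr B (MonoidHom.id (Perm X)))) (hr : ∀ g, inr g ∈ K) (x : X)
    (hl : ∀ b, inl (Pi.mulSingle x b) ∈ K) : K = ⊤ := by
  have hl' (y : X) (b : B) : inl (Pi.mulSingle y b) ∈ K := by
    rw [← swap_apply_left x y, ← inr_mul_inl_mulSingle_mul_inv]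
    exact K.mul_mem (K.mul_mem (hr _) (hl b)) (K.inv_mem (hr _))
  have hbase : K.comap inl = ⊤ := by
    have := Fintype.ofFinite X
    rw [eq_top_iff]
    intro f _
    exact Subgroup.pi_mem_of_mulSingle_mem f fun i => hl' i (f i)
  rw [eq_top_iff]
  intro w _
  rw [← inl_left_mul_inr_right w]
  refine K.mul_mem ?_ (hr _)
  exact (hbase ▸ Subgroup.mem_top w.left : w.left ∈ K.comap inl)

theorem map_pow_eq_one {G G' : Type*} [Group G] [Group G'] (i : G →* G') {g : G} {k : ℕ}
    (h : g ^ k = 1) : i g ^ k = 1 := by rw [← map_pow, h, map_one]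

theorem exists_card_le_three_closure_eq_top {A B X : Type*} [Group A] [Group B]
    [Finite X] [Nontrivial X]
    (hA : HasInvolutionOddGenerators A) (hB : HasInvolutionOddGenerators B)
    (hX : HasInvolutionOddGenerators (Perm X)) :
    ∃ S : Finset (A × Wr B (MonoidHom.id (Perm X))),
      S.card ≤ 3 ∧ Subgroup.closure (S : Set (A × Wr B (MonoidHom.id (Perm X)))) = ⊤ := by
  classical
  obtain ⟨sA, cA, hsA, ⟨kA, hkA, hcA⟩, genA⟩ := hA
  obtain ⟨sB, cB, hsB, ⟨kB, hkB, hcB⟩, genB⟩ := hB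
  obtain ⟨sX, cX, hsX, ⟨kX, hkX, hcX⟩, genX⟩ := hX
  obtain ⟨x, y, hxy⟩ := exists_pair_ne X
  let iA : A →* A × Wr B (MonoidHom.id (Perm X)) := MonoidHom.inl _ _
  let iW : Wr B (MonoidHom.id (Perm X)) →* A × Wr B (MonoidHom.id (Perm X)) := MonoidHom.inr _ _
  let iX : Perm X →* A × Wr B (MonoidHom.id (Perm X)) := iW.comp inr
  let iB (z : X) : B →* A × Wr B (MonoidHom.id (Perm X)) :=
    (iW.comp inl).comp (MonoidHom.mulSingle (fun _ : X => B) z)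
  have hAW : ∀ a w, Commute (iA a) (iW w) := MonoidHom.commute_inl_inr
  have hBB : Commute (iB x sB) (iB y cB) := by
    have h : Commute (MonoidHom.mulSingle (fun _ : X => B) x sB)
        (MonoidHom.mulSingle (fun _ : X => B) y cB) :=
      Pi.mulSingle_commute (f := fun _ : X => B) hxy sB cB
    exact h.map (iW.comp inl)
  suffices key : ∀ H : Subgroup (A × Wr B (MonoidHom.id (Perm X))),
      iA sA * iX cX ∈ H → iB x sB * iB y cB ∈ H → iX sX * iA cA ∈ H → H = ⊤ from
    ⟨{iA sA * iX cX, iB x sB * iB y cB, iX sX * iA cA}, Finset.card_le_three,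
      key _ (Subgroup.subset_closure (by simp)) (Subgroup.subset_closure (by simp))
        (Subgroup.subset_closure (by simp))⟩
  intro H hmA hmB hmX
  obtain ⟨m1, m2⟩ := (hAW sA (inr cX)).mem_and_mem_of_mul_mem (map_pow_eq_one iA hsA)
    ⟨kX, hkX, map_pow_eq_one iX hcX⟩ hmA
  obtain ⟨m3, m4⟩ := hBB.mem_and_mem_of_mul_mem (map_pow_eq_one (iB x) hsB)
    ⟨kB, hkB, map_pow_eq_one (iB y) hcB⟩ hmB
  obtain ⟨m5, m6⟩ := (hAW cA (inr sX)).symm.mem_and_mem_of_mul_mem (map_pow_eq_one iX hsX)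
    ⟨kA, hkA, map_pow_eq_one iA hcA⟩ hmX
  have tA : ∀ a, iA a ∈ H := fun a =>
    (genA (H.comap iA) m1 m6 ▸ Subgroup.mem_top a : a ∈ H.comap iA)
  have tX : ∀ g, iX g ∈ H := fun g =>
    (genX (H.comap iX) m5 m2 ▸ Subgroup.mem_top g : g ∈ H.comap iX)
  have hc : iB x cB ∈ H := by
    have h := congrArg iW (inr_mul_inl_mulSingle_mul_inv (swap y x) y cB)
    rw [swap_apply_left, map_mul, map_mul, map_inv] at h
    exact h ▸ H.mul_mem (H.mul_mem (tX (swap y x)) m4) (H.inv_mem (tX (swap y x)))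
  have tB : ∀ b, iB x b ∈ H := fun b =>
    (genB (H.comap (iB x)) m3 hc ▸ Subgroup.mem_top b : b ∈ H.comap (iB x))
  have tW : H.comap iW = ⊤ := eq_top_of_inr_mem_of_inl_mem _ tX x tB
  rw [eq_top_iff]
  rintro ⟨a, w⟩ _
  have hw : iW w ∈ H := (tW ▸ Subgroup.mem_top w : w ∈ H.comap iW)
  simpa [iA, iW] using H.mul_mem (tA a) hw

/-- The product of the characters given by `χ` on each coordinate of the base group. -/
def wrBaseHom {B C X G : Type*} [Group B] [CommGroup C] [Group G] [Fintype X] (ρ : G →* Perm X)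
    (χ : B →* C) : Wr B ρ →* C :=
  SemidirectProduct.lift
    { toFun := fun f => ∏ x, χ (f x)
      map_one' := by simp
      map_mul' := fun f g => by simp [Finset.prod_mul_distrib] } 1 fun g => by
    ext f
    simpa using Equiv.prod_comp (ρ g)⁻¹ fun x => χ (f x)

theorem three_le_rank_of_surjective {G : Type*} [Group G] [Group.FG G] (φ : G →* ℤˣ × ℤˣ × ℤˣ)
    (hφ : Function.Surjective φ) : 3 ≤ Group.rank G := by
  have h1 := card_dvd_exponent_pow_rank (ℤˣ × ℤˣ × ℤˣ)
  have h2 : Monoid.exponent (ℤˣ × ℤˣ × ℤˣ) ∣ 2 :=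
    Monoid.exponent_dvd_of_forall_pow_eq_one (by decide)
  have h3 := h1.trans (pow_dvd_pow_of_dvd h2 _)
  have h4 : Nat.card (ℤˣ × ℤˣ × ℤˣ) = 2 ^ 3 := by simp
  rw [h4] at h3
  exact ((Nat.pow_dvd_pow_iff_le_right (by norm_num)).1 h3).trans (Group.rank_le_of_surjective φ hφ)

theorem d_eq_three_of_surjective {G : Type*} [Group G]
    (hG : ∃ S : Finset G, S.card ≤ 3 ∧ Subgroup.closure (S : Set G) = ⊤)
    (φ : G →* ℤˣ × ℤˣ × ℤˣ) (hφ : Function.Surjective φ) : d G = 3 := by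
  obtain ⟨T, hT, hgen⟩ := hG
  have hmem : T.card ∈ {n | ∃ S : Finset G, S.card = n ∧ Subgroup.closure (S : Set G) = ⊤} :=
    ⟨T, rfl, hgen⟩
  refine le_antisymm ((Nat.sInf_le hmem).trans hT) (le_csInf ⟨_, hmem⟩ ?_)
  rintro _ ⟨S, rfl, hS⟩
  have : Group.FG G := ⟨S, hS⟩
  exact (three_le_rank_of_surjective φ hφ).trans (Group.rank_le hS)

end Wreath

theorem stmt_7 {Δ₁ Δ₂ Δ₃ : Type*} [Fintype Δ₁] [Fintype Δ₂] [Fintype Δ₃]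
    (h1 : 2 ≤ Fintype.card Δ₁) (h2 : 2 ≤ Fintype.card Δ₂) (h3 : 2 ≤ Fintype.card Δ₃) :
    d (Equiv.Perm Δ₁ × Wr (Equiv.Perm Δ₂) (MonoidHom.id (Equiv.Perm Δ₃))) = 3 := by
  classical
  have : Nontrivial Δ₁ := Fintype.one_lt_card_iff_nontrivial.1 h1
  have : Nontrivial Δ₂ := Fintype.one_lt_card_iff_nontrivial.1 h2
  have : Nontrivial Δ₃ := Fintype.one_lt_card_iff_nontrivial.1 h3
  refine d_eq_three_of_surjective
    (exists_card_le_three_closure_eq_top (hasInvolutionOddGenerators_perm Δ₁ h1)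
      (hasInvolutionOddGenerators_perm Δ₂ h2) (hasInvolutionOddGenerators_perm Δ₃ h3))
    (Equiv.Perm.sign.prodMap ((wrBaseHom _ Equiv.Perm.sign).prod
      (Equiv.Perm.sign.comp SemidirectProduct.rightHom))) ?_
  rintro ⟨a, b, c⟩
  obtain ⟨p, rfl⟩ := Equiv.Perm.sign_surjective Δ₁ a
  obtain ⟨q, rfl⟩ := Equiv.Perm.sign_surjective Δ₂ b
  obtain ⟨r, rfl⟩ := Equiv.Perm.sign_surjective Δ₃ c
  obtain ⟨x⟩ := (inferInstance : Nonempty Δ₃)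
  refine ⟨(p, SemidirectProduct.inl (Pi.mulSingle x q) * SemidirectProduct.inr r), ?_⟩
  simp [wrBaseHom, Pi.mulSingle_apply, apply_ite Equiv.Perm.sign]
end

section
/- Let Δ₁, Δ₂, Δ₃ be finite sets each of cardinality at least 2. Let W' = Sym(Δ₂) ≀_{Δ₃} Sym(Δ₃) (with Sym(Δ₃) acting naturally on Δ₃), and let W' act on Δ₂ × Δ₃ by the imprimitive product action: ((f, g)) • (δ₂, δ₃) = (f(g(δ₃))(δ₂), g(δ₃)) for f : Δ₃ → Sym(Δ₂) and g ∈ Sym(Δ₃). Then d(Sym(Δ₁) ≀_{Δ₂×Δ₃} W') = 3. -/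
/-- the imprimitive action of the wreath product `Sym(Δ₂) ≀_{Δ₃} Sym(Δ₃)` on `Δ₂ × Δ₃`,
`(f, g) • (δ₂, δ₃) = (f (g δ₃) δ₂, g δ₃)`, as a homomorphism to `Sym(Δ₂ × Δ₃)`. -/
def imprimHom (Δ₂ Δ₃ : Type*) :
    Wr (Equiv.Perm Δ₂) (MonoidHom.id (Equiv.Perm Δ₃)) →* Equiv.Perm (Δ₂ × Δ₃) where
  toFun w :=
    { toFun := fun p => (w.left (w.right p.2) p.1, w.right p.2)
      invFun := fun p => ((w.left p.2)⁻¹ p.1, w.right⁻¹ p.2)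
      left_inv := fun p => by simp
      right_inv := fun p => by simp }
  map_one' := Equiv.ext fun p => by simp
  map_mul' := fun a b => Equiv.ext fun p => by
    simp [SemidirectProduct.mul_left, SemidirectProduct.mul_right, wrAction,
      Equiv.Perm.mul_apply]

open Equiv Equiv.Perm Subgroup

namespace Equiv.Perm

variable {α : Type*} [Fintype α] [DecidableEq α]

theorem exists_isCycle_support_eq_univ (h : 2 ≤ Fintype.card α) :
    ∃ s : Perm α, s.IsCycle ∧ s.support = Finset.univ := by
  obtain ⟨s, hs⟩ := (exists_with_cycleType_iff (α := α) (m := {Fintype.card α})).2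
    ⟨by simp, by simpa using h⟩
  refine ⟨s, card_cycleType_eq_one.1 (by simp [hs]), ?_⟩
  rw [← Finset.card_eq_iff_eq_univ, ← sum_cycleType, hs, Multiset.sum_singleton]

theorem exists_isSwap_closure_pair_eq_top (h : 2 ≤ Fintype.card α) :
    ∃ σ τ : Perm α, σ.IsSwap ∧ sign τ = -1 ∧ Subgroup.closure {σ, τ} = ⊤ := by
  obtain ⟨s, hs, hsupp⟩ := exists_isCycle_support_eq_univ h
  obtain ⟨x, hx, -⟩ := id hs
  have hgen := closure_cycle_adjacent_swap hs hsupp x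
  rcases Int.units_eq_one_or (sign s) with hsign | hsign
  · refine ⟨swap x (s x), swap x (s x) * s, ⟨x, s x, hx.symm, rfl⟩,
      by simp [sign_swap hx.symm, hsign], ?_⟩
    rw [eq_top_iff, ← hgen, closure_le, Set.pair_subset_iff]
    have hσ := Subgroup.subset_closure (k := {swap x (s x), swap x (s x) * s}) (Set.mem_insert _ _)
    refine ⟨?_, hσ⟩
    have := mul_mem hσ (Subgroup.subset_closure (Set.mem_insert_of_mem _ (Set.mem_singleton _)))
    simpa using! this
  · exact ⟨swap x (s x), s, ⟨x, s x, hx.symm, rfl⟩, hsign, by rwa [Set.pair_comm]⟩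

theorem IsSwap.eq_top_of_mem {σ : Perm α} (hσ : σ.IsSwap) (N : Subgroup (Perm α)) [N.Normal]
    (h : σ ∈ N) : N = ⊤ := by
  rw [eq_top_iff, ← closure_isSwap, closure_le]
  rintro _ ⟨a, b, hab, rfl⟩
  obtain ⟨c, d, hcd, rfl⟩ := hσ
  obtain ⟨g, hg⟩ := isConj_iff.1 (isConj_swap hcd hab)
  rw [← hg]
  exact ‹N.Normal›.conj_mem _ h g

/-- If a transposition and a second permutation generate the symmetric group, then the normal
subgroups containing their commutator contain all even permutations. -/
theorem IsSwap.mem_of_sign_eq_one {σ τ : Perm α} (hσ : σ.IsSwap)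
    (hgen : Subgroup.closure {σ, τ} = ⊤) (N : Subgroup (Perm α)) [N.Normal]
    (h : τ * σ * τ⁻¹ * σ⁻¹ ∈ N) {g : Perm α} (hg : sign g = 1) : g ∈ N := by
  let q := QuotientGroup.mk' N
  have hcomm : ∀ g, q g * q σ = q σ * q g := by
    have : Subgroup.closure {σ, τ} ≤ (centralizer {q σ}).comap q := by
      rw [closure_le, Set.pair_subset_iff]
      refine ⟨by simp [mem_centralizer_iff], ?_⟩
      have := (QuotientGroup.eq_one_iff _).2 h
      change q (τ * σ * τ⁻¹ * σ⁻¹) = 1 at this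
      simp only [map_mul, map_inv] at this
      rw [mul_inv_eq_one, mul_inv_eq_iff_eq_mul] at this
      simp [mem_centralizer_iff, this]
    intro g
    have hg := this (hgen ▸ mem_top g)
    simpa [mem_centralizer_iff, eq_comm] using! hg
  have hswap : ∀ a b : α, a ≠ b → q (swap a b) = q σ := by
    intro a b hab
    obtain ⟨c, d, hcd, rfl⟩ := hσ
    obtain ⟨g, hg⟩ := isConj_iff.1 (isConj_swap hcd hab)
    rw [← hg, map_mul, map_mul, hcomm, map_inv, mul_inv_cancel_right]
  have hsq : q σ * q σ = 1 := by
    obtain ⟨c, d, hcd, rfl⟩ := hσ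
    rw [← map_mul, swap_mul_self, map_one]
  have key : ∀ g : Perm α, (sign g = 1 → q g = 1) ∧ (sign g = -1 → q g = q σ) := by
    intro g
    induction g using swap_induction_on with
    | one => simp
    | swap_mul f x y hxy ih =>
      rw [map_mul, map_mul, hswap x y hxy, sign_swap hxy]
      rcases Int.units_eq_one_or (sign f) with hf | hf
      · simp [hf, ih.1 hf]
      · simp [hf, ih.2 hf, hsq]
  exact (QuotientGroup.eq_one_iff _).1 ((key g).1 hg)

end Equiv.Perm

namespace Wr

open SemidirectProduct

section Coordinates

variable {H X G : Type*} [Group H] [Group G] {ρ : G →* Perm X}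

theorem mul_left_apply (a b : Wr H ρ) (x : X) :
    (a * b).left x = a.left x * b.left ((ρ a.right)⁻¹ x) := rfl

theorem right_pow (w : Wr H ρ) (k : ℕ) : (w ^ k).right = w.right ^ k :=
  map_pow (rightHom : Wr H ρ →* G) w k

theorem pow_left_apply (w : Wr H ρ) (x : X) {k : ℕ} (hk : 0 < k)
    (h : ∀ i, 0 < i → i < k → w.left ((ρ w.right ^ i)⁻¹ x) = 1) : (w ^ k).left x = w.left x := by
  induction k, hk using Nat.le_induction with
  | base => simp
  | succ k hk ih =>
    rw [pow_succ, mul_left_apply, ih fun i hi hik => h i hi (by omega), right_pow, map_pow,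
      h k hk (by omega), mul_one]

theorem exists_mem_right_eq {K : Subgroup (Wr H ρ)} (hK : K.map rightHom = ⊤) (g : G) :
    ∃ w ∈ K, w.right = g := by
  have : g ∈ K.map rightHom := hK ▸ mem_top g
  simpa using! this

theorem conj_mem_iff {K : Subgroup (Wr H ρ)} {w v : Wr H ρ} (hw : w ∈ K) :
    w * v * w⁻¹ ∈ K ↔ v ∈ K := by
  rw [K.mul_mem_cancel_right (inv_mem hw), K.mul_mem_cancel_left hw]

variable [DecidableEq X]

/-- The embedding of `H` into the wreath product as the coordinate subgroup at `x`. -/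
def single (ρ : G →* Perm X) (x : X) : H →* Wr H ρ :=
  inl.comp (MonoidHom.mulSingle (fun _ => H) x)

theorem single_apply (x : X) (n : H) : single ρ x n = inl (Pi.mulSingle x n) := rfl

theorem single_left_self (x : X) (n : H) : (single ρ x n).left x = n := by
  simp [single_apply]

theorem conj_single (w : Wr H ρ) (x : X) (n : H) :
    w * single ρ x n * w⁻¹ = single ρ (ρ w.right x)
      (w.left (ρ w.right x) * n * (w.left (ρ w.right x))⁻¹) := by
  rw [mul_inv_eq_iff_eq_mul]
  refine SemidirectProduct.ext (funext fun z => ?_) (by simp [single_apply])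
  rw [mul_left_apply, mul_left_apply]
  by_cases hz : z = ρ w.right x
  · subst hz
    simp [single_apply]
  · have : (ρ w.right).symm z ≠ x := fun h => hz (by rw [← h, apply_symm_apply])
    simp [single_apply, hz, this]

theorem inl_mem [Finite X] (K : Subgroup (Wr H ρ)) (f : X → H)
    (h : ∀ x, single ρ x (f x) ∈ K) : inl f ∈ K :=
  pi_mem_of_mulSingle_mem (H := K.comap inl) f h

theorem single_mem_iff {K : Subgroup (Wr H ρ)} {w : Wr H ρ} (hw : w ∈ K) (x : X) (n : H) :
    single ρ (ρ w.right x) n ∈ K ↔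
      single ρ x ((w.left (ρ w.right x))⁻¹ * n * w.left (ρ w.right x)) ∈ K := by
  rw [← conj_mem_iff hw (v := single ρ x _), conj_single]
  simp only [mul_assoc, mul_inv_cancel_left, mul_inv_cancel, mul_one]

theorem eq_top_of_single_mem [Finite X] {K : Subgroup (Wr H ρ)} (hK : K.map rightHom = ⊤)
    (htrans : ∀ x y, ∃ g, ρ g x = y) (x : X) (h : ∀ n, single ρ x n ∈ K) : K = ⊤ := by
  have hbase : ∀ f, inl f ∈ K := fun f => inl_mem K f fun y => by
    obtain ⟨g, rfl⟩ := htrans x y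
    obtain ⟨w, hw, rfl⟩ := exists_mem_right_eq hK g
    exact (single_mem_iff hw x _).2 (h _)
  refine eq_top_iff.2 fun w _ => ?_
  obtain ⟨k, hk, hkw⟩ := exists_mem_right_eq hK w.right
  have : w = inl (w * k⁻¹).left * k := by
    rw [← mul_inv_eq_iff_eq_mul]
    refine SemidirectProduct.ext rfl (by simp [hkw])
  rw [this]
  exact mul_mem (hbase _) hk

theorem normal_comap_single (K : Subgroup (Wr H ρ)) (x : X) {S : Set H} (hS : closure S = ⊤)
    (h : ∀ s ∈ S, ∃ w ∈ K, ρ w.right x = x ∧ w.left x = s) : (K.comap (single ρ x)).Normal := by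
  rw [← normalizer_eq_top_iff, eq_top_iff, ← hS, closure_le]
  intro s hs
  obtain ⟨w, hw, hfix, rfl⟩ := h s hs
  refine mem_normalizer_iff.2 fun n => ?_
  rw [mem_comap, mem_comap, ← conj_mem_iff hw (v := single ρ x n), conj_single, hfix]

theorem exists_pow_fix_left_eq [Finite X] (x : X) (n : H) (g : G) :
    ∃ k, ρ ((inl (Pi.mulSingle x n) * inr g : Wr H ρ) ^ k).right x = x ∧
      ((inl (Pi.mulSingle x n) * inr g : Wr H ρ) ^ k).left x = n := by
  have hex : ∃ k, 0 < k ∧ (ρ g ^ k) x = x :=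
    ⟨orderOf (ρ g), orderOf_pos _, by rw [pow_orderOf_eq_one, one_apply]⟩
  refine ⟨Nat.find hex, ?_, ?_⟩
  · rw [right_pow, map_pow]
    simpa using (Nat.find_spec hex).2
  · rw [pow_left_apply _ _ (Nat.find_spec hex).1]
    · simp
    · intro i hi hik
      have h : (ρ g ^ i)⁻¹ x ≠ x := fun h => Nat.find_min hex hik ⟨hi, (inv_eq_iff_eq.1 h).symm⟩
      simpa using! Pi.mulSingle_eq_of_ne (M := fun _ => H) h n

end Coordinates

section Symmetric

variable {Δ X G : Type*} [Fintype Δ] [DecidableEq Δ] [Finite X] [DecidableEq X] [Group G]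
  {ρ : G →* Perm X}

theorem eq_top_of_single_isSwap_mem {K : Subgroup (Wr (Perm Δ) ρ)} (hK : K.map rightHom = ⊤)
    (htrans : ∀ x y, ∃ g, ρ g x = y) (x : X) {σ τ : Perm Δ} (hσ : σ.IsSwap)
    (hgen : Subgroup.closure {σ, τ} = ⊤) (hmem : single ρ x σ ∈ K)
    (hτ : ∃ w ∈ K, ρ w.right x = x ∧ w.left x = τ) : K = ⊤ := by
  have : (K.comap (single ρ x)).Normal := by
    refine normal_comap_single K x hgen ?_
    rintro s (rfl | rfl)
    · exact ⟨_, hmem, by simp [single_apply], single_left_self x s⟩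
    · exact hτ
  have htop := hσ.eq_top_of_mem (K.comap (single ρ x)) hmem
  exact eq_top_of_single_mem hK htrans x fun n => (htop ▸ mem_top n : n ∈ K.comap (single ρ x))

/-- A wreath product of a symmetric group by a transitive two-generator group is generated by
three elements. -/
theorem exists_closure_triple_eq_top [Nonempty X] (hΔ : 2 ≤ Fintype.card Δ)
    (htrans : ∀ x y, ∃ g, ρ g x = y) {g₁ g₂ : G} (hG : Subgroup.closure {g₁, g₂} = ⊤) :
    ∃ a b c : Wr (Perm Δ) ρ, Subgroup.closure {a, b, c} = ⊤ := by
  obtain ⟨σ, τ, hσ, -, hgen⟩ := exists_isSwap_closure_pair_eq_top hΔ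
  obtain ⟨x⟩ := ‹Nonempty X›
  set a : Wr (Perm Δ) ρ := inl (Pi.mulSingle x τ) * inr g₁
  have hsub := Subgroup.subset_closure (G := Wr (Perm Δ) ρ) (k := {a, inr g₂, single ρ x σ})
  refine ⟨a, inr g₂, single ρ x σ, eq_top_of_single_isSwap_mem ?_ htrans x hσ hgen
    (hsub (by simp)) ?_⟩
  · rw [eq_top_iff, ← hG, closure_le, Set.pair_subset_iff]
    exact ⟨⟨a, hsub (by simp), by simp [a]⟩, ⟨inr g₂, hsub (by simp), by simp⟩⟩
  · obtain ⟨k, hk⟩ := exists_pow_fix_left_eq (ρ := ρ) x τ g₁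
    exact ⟨a ^ k, pow_mem (hsub (by simp)) k, hk⟩

end Symmetric

section TwoGenerators

variable {Δ X : Type*} [Fintype Δ] [DecidableEq Δ]

theorem sign_left_apply_of_commute {w f : Wr (Perm Δ) (MonoidHom.id (Perm X))} (h : Commute w f)
    (hf : f.right = 1) (x : X) : sign (f.left (w.right x)) = sign (f.left x) := by
  have := congrArg (fun v : Wr (Perm Δ) (MonoidHom.id (Perm X)) => sign (v.left (w.right x))) h.eq
  simp only [mul_left_apply, hf, map_one, inv_one, Perm.one_apply, MonoidHom.id_apply,
    Perm.inv_def, symm_apply_apply, Perm.sign_mul] at this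
  rw [mul_comm] at this
  exact (mul_right_cancel this).symm

variable [DecidableEq X]

theorem exists_apply_eq (x y : X) : ∃ g : Perm X, MonoidHom.id (Perm X) g x = y :=
  ⟨swap x y, by simp⟩

variable [Fintype X]

theorem exists_closure_pair_eq_top_of_even (hΔ : 2 ≤ Fintype.card Δ) (hX : 2 ≤ Fintype.card X)
    (heven : Even (Fintype.card X)) :
    ∃ a b : Wr (Perm Δ) (MonoidHom.id (Perm X)), Subgroup.closure {a, b} = ⊤ := by
  obtain ⟨σ, τ, hσ, -, hgen⟩ := exists_isSwap_closure_pair_eq_top hΔ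
  obtain ⟨s, hs, hsupp⟩ := exists_isCycle_support_eq_univ hX
  obtain ⟨q, hq, -⟩ := id hs
  have hst := closure_cycle_adjacent_swap hs hsupp q
  set t := swap q (s q)
  set r := t * s
  have hrq : r q = q := by simp [r, t]
  have hr : r ^ (Fintype.card X - 1) = 1 := by
    by_cases hsq : s (s q) = q
    · have hr1 : r = 1 := (congrArg (t * ·) (hs.eq_swap_of_apply_apply_eq_self hq hsq)).trans
        (swap_mul_self q (s q))
      rw [hr1, one_pow]
    · rw [← Finset.card_univ, ← hsupp, ← Finset.card_erase_of_mem (mem_support.2 hq),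
        Finset.erase_eq, ← support_swap_mul_eq s q hsq, ← (hs.swap_mul hq hsq).orderOf]
      exact pow_orderOf_eq_one _
  have hodd : Odd (Fintype.card X - 1) := Nat.Even.sub_odd (by omega) heven odd_one
  set a : Wr (Perm Δ) (MonoidHom.id (Perm X)) := single _ q σ * inr r
  set b : Wr (Perm Δ) (MonoidHom.id (Perm X)) := inl (Pi.mulSingle q τ) * inr t
  have hcomm : Commute (single (MonoidHom.id (Perm X)) q σ) (inr r) := by
    have := conj_single (inr r : Wr (Perm Δ) (MonoidHom.id (Perm X))) q σ
    rw [mul_inv_eq_iff_eq_mul] at this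
    simpa [hrq] using! this.symm
  have hσσ : σ ^ 2 = 1 := by
    obtain ⟨c, d, hcd, rfl⟩ := hσ
    rw [sq, swap_mul_self]
  have hpow : a ^ (Fintype.card X - 1) = single _ q σ := by
    obtain ⟨m, hm⟩ := hodd
    rw [hcomm.mul_pow, ← map_pow, ← map_pow, hr, map_one, mul_one, hm, pow_succ, pow_mul, hσσ,
      one_pow, one_mul]
  have hsub := Subgroup.subset_closure (G := Wr (Perm Δ) (MonoidHom.id (Perm X))) (k := {a, b})
  refine ⟨a, b, eq_top_of_single_isSwap_mem ?_ exists_apply_eq q hσ hgen ?_ ?_⟩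
  · have hrr : r ∈ (Subgroup.closure {a, b}).map rightHom :=
      ⟨a, hsub (by simp), by simp [a, single_apply]⟩
    have ht : t ∈ (Subgroup.closure {a, b}).map rightHom := ⟨b, hsub (by simp), by simp [b]⟩
    rw [eq_top_iff, ← hst, closure_le, Set.pair_subset_iff]
    refine ⟨?_, ht⟩
    simpa [r, t] using! mul_mem ht hrr
  · exact hpow ▸ pow_mem (hsub (by simp)) _
  · obtain ⟨k, hk⟩ := exists_pow_fix_left_eq (ρ := MonoidHom.id (Perm X)) q τ t
    exact ⟨b ^ k, pow_mem (hsub (by simp)) k, hk⟩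

theorem exists_closure_pair_eq_top_of_odd (hΔ : 2 ≤ Fintype.card Δ) (hX : 2 ≤ Fintype.card X)
    (hodd : Odd (Fintype.card X)) :
    ∃ a b : Wr (Perm Δ) (MonoidHom.id (Perm X)), Subgroup.closure {a, b} = ⊤ := by
  obtain ⟨σ, τ, hσ, hτ, hgen⟩ := exists_isSwap_closure_pair_eq_top hΔ
  obtain ⟨s, hs, hsupp⟩ := exists_isCycle_support_eq_univ hX
  obtain ⟨q, hq, -⟩ := id hs
  have hst := closure_cycle_adjacent_swap hs hsupp q
  have hsc : s ^ Fintype.card X = 1 := by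
    rw [← Finset.card_univ, ← hsupp, ← hs.orderOf, pow_orderOf_eq_one]
  have hsq : s (s q) ≠ q := fun h => by
    have := card_support_swap hq.symm
    rw [← hs.eq_swap_of_apply_apply_eq_self hq h, hsupp, Finset.card_univ] at this
    rw [this] at hodd
    exact absurd hodd (by decide)
  have hrc := hs.swap_mul hq hsq
  have hrsupp := support_swap_mul_eq s q hsq
  set t := swap q (s q)
  set r := t * s
  set p := s q
  have hrq : r q = q := by simp [r, t]
  have hrp : r p ≠ p := by rw [← mem_support, hrsupp, hsupp]; simpa using hq
  set k := orderOf r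
  have hk : 0 < k := orderOf_pos r
  have hkfix : ∀ i, 0 < i → i < k → (r ^ i) p ≠ p := fun i hi hik h => by
    have := (hrc.pow_eq_one_iff' hrp).2 h
    exact absurd (orderOf_le_of_pow_eq_one hi this) (by simpa [k] using hik)
  set D : Wr (Perm Δ) (MonoidHom.id (Perm X)) := inl fun _ => σ
  set a : Wr (Perm Δ) (MonoidHom.id (Perm X)) := D * inr s
  set b : Wr (Perm Δ) (MonoidHom.id (Perm X)) := inl (Pi.mulSingle p τ) * inr t
  have hσσ : σ ^ 2 = 1 := by
    obtain ⟨c, d, hcd, rfl⟩ := hσ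
    rw [sq, swap_mul_self]
  have hcomm : Commute D (inr s) := by
    refine SemidirectProduct.ext (funext fun x => ?_) (by simp [D])
    rw [mul_left_apply, mul_left_apply]
    simp [D]
  have hD : a ^ Fintype.card X = D := by
    obtain ⟨m, hm⟩ := hodd
    have : D ^ 2 = 1 := by
      rw [← map_pow, ← map_one inl]
      congr 1
      exact funext fun _ => hσσ
    rw [hcomm.mul_pow, ← map_pow inr, hsc, map_one, mul_one, hm, pow_succ, pow_mul, this, one_pow,
      one_mul]
  have hsub := Subgroup.subset_closure (G := Wr (Perm Δ) (MonoidHom.id (Perm X))) (k := {a, b})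
  set K : Subgroup (Wr (Perm Δ) (MonoidHom.id (Perm X))) := Subgroup.closure {a, b}
  have ha : a ∈ K := hsub (by simp)
  have hb : b ∈ K := hsub (by simp)
  have hDK : D ∈ K := hD ▸ pow_mem ha _
  have hsK : inr s ∈ K := (K.mul_mem_cancel_left hDK).1 ha
  have hK : K.map rightHom = ⊤ := by
    rw [eq_top_iff, ← hst, closure_le, Set.pair_subset_iff]
    exact ⟨⟨a, ha, by simp [a, D]⟩, ⟨b, hb, by simp [b]⟩⟩
  set z : Wr (Perm Δ) (MonoidHom.id (Perm X)) := inl (Pi.mulSingle p τ) * inr r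
  have hzK : z ∈ K := by
    have : z = b * inr s := by simp [z, b, r, mul_assoc]
    exact this ▸ mul_mem hb hsK
  have hzright : z.right = r := by simp [z]
  have hzleft : z.left = Pi.mulSingle p τ := by simp [z]
  have hFright : (z ^ k).right = 1 := by rw [right_pow, hzright, pow_orderOf_eq_one]
  have hFp : (z ^ k).left p = τ := by
    rw [pow_left_apply _ _ hk, hzleft, Pi.mulSingle_eq_same]
    intro i hi hik
    have h : (r ^ i)⁻¹ p ≠ p := fun h => hkfix i hi hik (inv_eq_iff_eq.1 h).symm
    rw [hzleft, hzright, MonoidHom.id_apply, Pi.mulSingle_eq_of_ne h]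
  have hFq : (z ^ k).left q = 1 := by
    have hpq : q ≠ p := hq.symm
    rw [pow_left_apply _ _ hk, hzleft, Pi.mulSingle_eq_of_ne hpq]
    intro i hi hik
    have : (r ^ i)⁻¹ q = q := inv_eq_iff_eq.2 (pow_apply_eq_self_of_apply_eq_self hrq i).symm
    rw [hzleft, hzright, MonoidHom.id_apply, this, Pi.mulSingle_eq_of_ne hpq]
  have hFsign : ∀ x, x ≠ q → sign ((z ^ k).left x) = -1 := by
    intro x hx
    have hrx : r x ≠ x := by rw [← mem_support, hrsupp, hsupp]; simpa using hx
    obtain ⟨i, rfl⟩ := hrc.exists_pow_eq hrp hrx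
    clear hx hrx
    induction i with
    | zero => simp [hFp, hτ]
    | succ i ih =>
      rw [← ih, pow_succ', Perm.mul_apply]
      simpa [hzright] using
        sign_left_apply_of_commute ((Commute.refl z).pow_right k) hFright ((r ^ i) p)
  have hFK : z ^ k ∈ K := pow_mem hzK k
  have hnormal : (K.comap (single _ p)).Normal := by
    refine normal_comap_single K p hgen ?_
    rintro _ (rfl | rfl)
    · exact ⟨D, hDK, by simp [D], by simp [D]⟩
    · exact ⟨z ^ k, hFK, by simp [hFright], hFp⟩
  have hp : ∀ g, sign g = 1 → single _ p g ∈ K := by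
    intro g hg
    refine hσ.mem_of_sign_eq_one hgen (K.comap (single _ p)) ?_ hg
    have : single (MonoidHom.id (Perm X)) p (τ * σ * τ⁻¹ * σ⁻¹) = b * D * b⁻¹ * D⁻¹ := by
      rw [eq_mul_inv_iff_mul_eq, eq_mul_inv_iff_mul_eq]
      refine SemidirectProduct.ext (funext fun x => ?_) (by simp [single_apply, D])
      simp only [mul_left_apply]
      by_cases hx : x = p
      · subst hx
        simp [single_apply, b, D]
      · simp [single_apply, b, D, hx]
    rw [mem_comap, this]
    exact mul_mem (mul_mem (mul_mem hb hDK) (inv_mem hb)) (inv_mem hDK)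
  have heven : ∀ x g, sign g = 1 → single _ x g ∈ K := by
    intro x g hg
    obtain ⟨g', rfl⟩ := exists_apply_eq p x
    obtain ⟨w, hw, rfl⟩ := exists_mem_right_eq hK g'
    refine (single_mem_iff hw p _).2 (hp _ ?_)
    rw [Perm.sign_mul, Perm.sign_mul, hg, mul_one, ← Perm.sign_mul, inv_mul_cancel, Perm.sign_one]
  have hE : inl (fun x => if x = q then 1 else σ * (z ^ k).left x) ∈ K := by
    refine inl_mem K _ fun x => heven x _ ?_
    split_ifs with hx
    · exact Perm.sign_one
    · rw [Perm.sign_mul, hFsign x hx, hσ.sign_eq]; rfl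
  have hqσ : single _ q σ ∈ K := by
    have : single (MonoidHom.id (Perm X)) q σ *
        inl (fun x => if x = q then 1 else σ * (z ^ k).left x) = D * z ^ k := by
      refine SemidirectProduct.ext (funext fun x => ?_) (by simp [single_apply, D, hFright])
      simp only [mul_left_apply]
      by_cases hx : x = q
      · subst hx
        simp [single_apply, D, hFq]
      · simp [single_apply, D, hx]
    exact (K.mul_mem_cancel_right hE).1 (this ▸ mul_mem hDK hFK)
  refine ⟨a, b, eq_top_of_single_mem hK exists_apply_eq q fun n => ?_⟩
  rcases Int.units_eq_one_or (sign n) with hn | hn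
  · exact heven q n hn
  · have := mul_mem (heven q (n * σ⁻¹) (by simp [hn, hσ.sign_eq])) hqσ
    rwa [← map_mul, inv_mul_cancel_right] at this

theorem exists_closure_pair_eq_top (hΔ : 2 ≤ Fintype.card Δ) (hX : 2 ≤ Fintype.card X) :
    ∃ a b : Wr (Perm Δ) (MonoidHom.id (Perm X)), Subgroup.closure {a, b} = ⊤ :=
  (Nat.even_or_odd (Fintype.card X)).elim (exists_closure_pair_eq_top_of_even hΔ hX)
    (exists_closure_pair_eq_top_of_odd hΔ hX)

end TwoGenerators

section Sign

variable {Δ X G : Type*} [Fintype Δ] [DecidableEq Δ] [Fintype X] [Group G]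

/-- The product of the signs of the coordinates in the base group. -/
def prodSign (ρ : G →* Perm X) : Wr (Perm Δ) ρ →* ℤˣ where
  toFun w := ∏ x, sign (w.left x)
  map_one' := by simp
  map_mul' a b := by
    simp only [mul_left_apply, Perm.sign_mul, Finset.prod_mul_distrib]
    rw [Equiv.prod_comp (ρ a.right)⁻¹ fun x => sign (b.left x)]

theorem prodSign_apply {ρ : G →* Perm X} (w : Wr (Perm Δ) ρ) :
    prodSign ρ w = ∏ x, sign (w.left x) := rfl

theorem exists_left_prodSign_eq [Nontrivial Δ] [Nonempty X] (ρ : G →* Perm X) (g : G) (e : ℤˣ) :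
    ∃ w : Wr (Perm Δ) ρ, w.right = g ∧ prodSign ρ w = e := by
  classical
  obtain ⟨π, rfl⟩ := sign_surjective Δ e
  obtain ⟨x⟩ := ‹Nonempty X›
  refine ⟨⟨Pi.mulSingle x π, g⟩, rfl, ?_⟩
  rw [prodSign_apply, Finset.prod_eq_single x (by simp +contextual) (by simp)]
  simp

end Sign

end Wr

/-- An elementary abelian group of order `8` is not generated by two elements. -/
theorem closure_pair_ne_top_units_prod (a b : ℤˣ × ℤˣ × ℤˣ) : Subgroup.closure {a, b} ≠ ⊤ := by
  intro h
  obtain ⟨c, h1, ha, hb, hab⟩ : ∃ c : ℤˣ × ℤˣ × ℤˣ, c ≠ 1 ∧ c ≠ a ∧ c ≠ b ∧ c ≠ a * b := by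
    clear h; revert a b; decide
  have hc : c ∈ Subgroup.closure {a, b} := h ▸ mem_top c
  obtain ⟨m, n, rfl⟩ := mem_closure_pair.1 hc
  have hsq : ∀ x : ℤˣ × ℤˣ × ℤˣ, x ^ (2 : ℤ) = 1 := by decide
  have key : ∀ (x : ℤˣ × ℤˣ × ℤˣ) (m : ℤ), x ^ m = 1 ∨ x ^ m = x := by
    intro x m
    obtain ⟨k, rfl | rfl⟩ := Int.even_or_odd' m
    · simp [zpow_mul, hsq]
    · simp [zpow_add, zpow_mul, hsq]
  rcases key a m with hm | hm <;> rcases key b n with hn | hn <;> simp_all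

theorem stmt_10 {Δ₁ Δ₂ Δ₃ : Type*} [Fintype Δ₁] [Fintype Δ₂] [Fintype Δ₃]
    (h1 : 2 ≤ Fintype.card Δ₁) (h2 : 2 ≤ Fintype.card Δ₂) (h3 : 2 ≤ Fintype.card Δ₃) :
    d (Wr (Equiv.Perm Δ₁) (imprimHom Δ₂ Δ₃)) = 3 := by
  classical
  have : Nontrivial Δ₁ := Fintype.one_lt_card_iff_nontrivial.1 h1
  have : Nontrivial Δ₂ := Fintype.one_lt_card_iff_nontrivial.1 h2
  have : Nontrivial Δ₃ := Fintype.one_lt_card_iff_nontrivial.1 h3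
  have htrans : ∀ x y, ∃ g, imprimHom Δ₂ Δ₃ g x = y := fun x y =>
    ⟨⟨fun _ => swap x.1 y.1, swap x.2 y.2⟩, by simp [imprimHom]⟩
  obtain ⟨g₁, g₂, hg⟩ := Wr.exists_closure_pair_eq_top h2 h3
  obtain ⟨a, b, c, habc⟩ := Wr.exists_closure_triple_eq_top h1 htrans hg
  let φ : Wr (Perm Δ₁) (imprimHom Δ₂ Δ₃) →* ℤˣ × ℤˣ × ℤˣ :=
    (Wr.prodSign _).prod (((Wr.prodSign _).prod
      (sign.comp SemidirectProduct.rightHom)).comp SemidirectProduct.rightHom)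
  have hφ : Function.Surjective φ := by
    rintro ⟨e₁, e₂, e₃⟩
    obtain ⟨π, rfl⟩ := sign_surjective Δ₃ e₃
    obtain ⟨v, rfl, rfl⟩ := Wr.exists_left_prodSign_eq (Δ := Δ₂) (MonoidHom.id (Perm Δ₃)) π e₂
    obtain ⟨w, rfl, rfl⟩ := Wr.exists_left_prodSign_eq (Δ := Δ₁) (imprimHom Δ₂ Δ₃) v e₁
    exact ⟨w, rfl⟩
  have lower : ∀ S : Finset (Wr (Perm Δ₁) (imprimHom Δ₂ Δ₃)),
      Subgroup.closure (S : Set (Wr (Perm Δ₁) (imprimHom Δ₂ Δ₃))) = ⊤ → 3 ≤ S.card := by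
    intro S hS
    by_contra! hcard
    obtain ⟨x, y, hxy⟩ : ∃ x y, S ⊆ {x, y} := by
      rcases (by omega : S.card = 0 ∨ S.card = 1 ∨ S.card = 2) with h | h | h
      · exact ⟨1, 1, by simp [Finset.card_eq_zero.1 h]⟩
      · obtain ⟨x, rfl⟩ := Finset.card_eq_one.1 h
        exact ⟨x, x, by simp⟩
      · obtain ⟨x, y, -, rfl⟩ := Finset.card_eq_two.1 h
        exact ⟨x, y, subset_rfl⟩
    have hxy' : Subgroup.closure {x, y} = ⊤ :=
      eq_top_iff.2 (hS ▸ Subgroup.closure_mono (by simpa using Finset.coe_subset.2 hxy))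
    refine closure_pair_ne_top_units_prod (φ x) (φ y) ?_
    rw [← Set.image_pair, ← MonoidHom.map_closure, hxy', map_top_of_surjective φ hφ]
  have hmem : ({a, b, c} : Finset _).card ∈ {n | ∃ S : Finset (Wr (Perm Δ₁) (imprimHom Δ₂ Δ₃)),
      S.card = n ∧ Subgroup.closure (S : Set (Wr (Perm Δ₁) (imprimHom Δ₂ Δ₃))) = ⊤} :=
    ⟨{a, b, c}, rfl, by simpa using habc⟩
  refine le_antisymm ((Nat.sInf_le hmem).trans Finset.card_le_three) ?_
  obtain ⟨S, hS, htop⟩ := Nat.sInf_mem ⟨_, hmem⟩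
  exact (lower S htop).trans_eq hS
end
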